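/- Let G1 and G2 be two distinct undirected graphs on the same vertex set V with |V| = n. Then there exist vertices u, v in V and at least 2^(n - 2 - κ(G1)) distinct sets S ⊆ V \ {u, v} such that S separates u and v in exactly one of G1 and G2, where κ(G1) is the maximum pairwise connectivity of G1. -/

import Mathlib

/-- `S` separates `u` and `v` in `G`: every `u`–`v` walk contains a vertex of `S`
(with `S` disjoint from `{u, v}`, such a vertex is internal). -/
def Separates {n : ℕ} (G : SimpleGraph (Fin n)) (u v : Fin n) (S : Finset (Fin n)) : Prop :=
  ∀ p : G.Walk u v, ∃ w ∈ p.support, w ∈ S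

/-- The separation distance between two graphs on `Fin n`: the number of triples
`(x, y, S)` with `x < y` (so each unordered pair is counted once) and
`S ⊆ V \ {x, y}` on which the separation relations of the two graphs differ. -/
noncomputable def sepDist {n : ℕ} (G₁ G₂ : SimpleGraph (Fin n)) : ℕ :=
  Set.ncard {t : Fin n × Fin n × Finset (Fin n) |
    t.1 < t.2.1 ∧ t.1 ∉ t.2.2 ∧ t.2.1 ∉ t.2.2 ∧
    ¬ (Separates G₁ t.1 t.2.1 t.2.2 ↔ Separates G₂ t.1 t.2.1 t.2.2)}

/-- The pairwise connectivity `κ(u, v, G)`: the maximum number of internally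
vertex-disjoint `u`–`v` paths, each having at least one internal vertex. -/
noncomputable def pairConn {n : ℕ} (G : SimpleGraph (Fin n)) (u v : Fin n) : ℕ :=
  sSup {k : ℕ | ∃ P : Fin k → G.Walk u v,
    (∀ i, (P i).IsPath ∧ 2 ≤ (P i).length) ∧
    ∀ i j, i ≠ j → ∀ w, w ∈ (P i).support → w ∈ (P j).support → w = u ∨ w = v}

/-- The maximum pairwise connectivity `κ(G)`. -/
noncomputable def maxPairConn {n : ℕ} (G : SimpleGraph (Fin n)) : ℕ :=
  sSup {k : ℕ | ∃ u v : Fin n, u ≠ v ∧ k = pairConn G u v}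

section Menger

variable {V : Type*}

/-- The list `l` is a walk from `A` to `B` in the digraph with arc set `E`. -/
def IsLink (E : Finset (V × V)) (A B : Finset V) (l : List V) : Prop :=
  l.IsChain (fun a b => (a, b) ∈ E) ∧ (∃ a ∈ A, l.head? = some a) ∧
    ∃ b ∈ B, l.getLast? = some b

/-- Every walk from `A` to `B` in the digraph with arc set `E` meets `S`. -/
def SeparatesSets (E : Finset (V × V)) (A B S : Finset V) : Prop :=
  ∀ l, IsLink E A B l → ∃ w ∈ l, w ∈ S

theorem SeparatesSets.eq_of_mem_of_mem {E : Finset (V × V)} {A B S P Q : Finset V}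
    (hS : SeparatesSets E A B S) (hSP : S ⊆ P) (hSQ : S ⊆ Q) {f g : V → List V}
    (hf : ∀ p ∈ P, (f p).getLast? = some p ∧ IsLink E A P (f p) ∧ (f p).Nodup)
    (hg : ∀ q ∈ Q, (g q).head? = some q ∧ IsLink E Q B (g q) ∧ (g q).Nodup)
    (hfd : ∀ p ∈ P, ∀ q ∈ P, ∀ w, w ∈ f p → w ∈ f q → p = q)
    (hgd : ∀ p ∈ Q, ∀ q ∈ Q, ∀ w, w ∈ g p → w ∈ g q → p = q)
    {p q w : V} (hp : p ∈ P) (hq : q ∈ Q) (hwp : w ∈ f p) (hwq : w ∈ g q) :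
    w = p ∧ w = q ∧ w ∈ S := by
  obtain ⟨hlast, ⟨hc₁, ⟨a, ha, hla⟩, -⟩, hn₁⟩ := hf p hp
  obtain ⟨hhead, ⟨hc₂, -, ⟨b, hb, hlb⟩⟩, hn₂⟩ := hg q hq
  have key₁ : ∀ z ∈ f p, z ∈ S → z = p := fun z hz hzS =>
    hfd z (hSP hzS) p hp z (List.mem_of_getLast? (hf z (hSP hzS)).1) hz
  have key₂ : ∀ z ∈ g q, z ∈ S → z = q := fun z hz hzS =>
    hgd z (hSQ hzS) q hq z (List.mem_of_head? (hg z (hSQ hzS)).1) hz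
  obtain ⟨l₁, l₂, h₁⟩ := List.append_of_mem hwp
  obtain ⟨m₁, m₂, h₂⟩ := List.append_of_mem hwq
  rw [h₁] at hc₁ hla hlast hn₁ key₁
  rw [h₂] at hc₂ hlb hhead hn₂ key₂
  rw [List.isChain_split] at hc₁ hc₂
  obtain ⟨z, hz, hzS⟩ := hS (l₁ ++ w :: m₂)
    ⟨List.isChain_split.2 ⟨hc₁.1, hc₂.2⟩, ⟨a, ha, by cases l₁ <;> simpa using hla⟩,
      ⟨b, hb, by simpa [List.getLast?_append] using hlb⟩⟩
  have hp' : p ∈ w :: l₂ := List.mem_of_getLast? (by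
    simpa [List.getLast?_append] using hlast)
  have hq' : q ∈ m₁ ++ [w] := List.mem_of_head? (by
    cases m₁ <;> simpa using hhead)
  have hzw : z = w := by
    simp only [List.mem_append, List.mem_cons] at hz
    rcases hz with hz | hz | hz
    · have := key₁ z (by simp [hz]) hzS
      grind
    · exact hz
    · have := key₂ z (by simp [hz]) hzS
      grind
  subst hzw
  exact ⟨key₁ z (by simp) hzS, key₂ z (by simp) hzS, hzS⟩

variable [DecidableEq V]

theorem isChain_of_insert_of_notMem_init {E : Finset (V × V)} {x y z : V} {l : List V}
    (h : (l ++ [z]).IsChain (fun a b => (a, b) ∈ insert (x, y) E)) (hx : x ∉ l) :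
    (l ++ [z]).IsChain (fun a b => (a, b) ∈ E) := by
  induction l using List.twoStepInduction with grind

theorem isChain_of_insert_of_notMem_tail {E : Finset (V × V)} {x y z : V} {l : List V}
    (h : (z :: l).IsChain (fun a b => (a, b) ∈ insert (x, y) E)) (hy : y ∉ l) :
    (z :: l).IsChain (fun a b => (a, b) ∈ E) := by
  induction l generalizing z with grind

theorem List.exists_eq_append_cons_first {P : Finset V} {l : List V} (h : ∃ w ∈ l, w ∈ P) :
    ∃ l₁ z l₂, l = l₁ ++ z :: l₂ ∧ z ∈ P ∧ ∀ w ∈ l₁, w ∉ P := by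
  induction l with
  | nil => simp at h
  | cons a l ih =>
    by_cases ha : a ∈ P
    · exact ⟨[], a, l, by simp [ha]⟩
    · obtain ⟨l₁, z, l₂, rfl, hz, h₁⟩ := ih (by grind)
      exact ⟨a :: l₁, z, l₂, by simp, hz, by grind⟩

theorem List.exists_eq_append_cons_last {P : Finset V} {l : List V} (h : ∃ w ∈ l, w ∈ P) :
    ∃ l₁ z l₂, l = l₁ ++ z :: l₂ ∧ z ∈ P ∧ ∀ w ∈ l₂, w ∉ P := by
  obtain ⟨l₁, z, l₂, h₁, hz, h₂⟩ :=
    List.exists_eq_append_cons_first (P := P) (l := l.reverse) (by simpa using h)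
  refine ⟨l₂.reverse, z, l₁.reverse, ?_, hz, by simpa using h₂⟩
  rw [← List.reverse_reverse l, h₁]
  simp

theorem SeparatesSets.mem_or_mem_of_insert {E : Finset (V × V)} {A B S : Finset V} {x y : V}
    (hS : SeparatesSets E A B S) {l : List V} (hl : IsLink (insert (x, y) E) A B l) :
    (∃ w ∈ l, w ∈ S) ∨ (x ∈ l ∧ y ∈ l) := by
  by_contra! hcon
  obtain ⟨hc, ⟨a, ha, hla⟩, ⟨b, hb, hlb⟩⟩ := hl
  have hE : l.IsChain (fun a b => (a, b) ∈ E) := by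
    by_cases hx : x ∈ l
    · have hy := hcon.2 hx
      cases l with
      | nil => simp
      | cons z l => exact isChain_of_insert_of_notMem_tail hc (by grind)
    · obtain rfl | ⟨l', z, rfl⟩ := l.eq_nil_or_concat
      · simp
      · simp only [List.concat_eq_append] at *
        exact isChain_of_insert_of_notMem_init hc (by grind)
  obtain ⟨w, hw, hwS⟩ := hS l ⟨hE, ⟨a, ha, hla⟩, ⟨b, hb, hlb⟩⟩
  exact hcon.1 w hw hwS

theorem SeparatesSets.insert_left {E : Finset (V × V)} {A B S T : Finset V} {x y : V}
    (hS : SeparatesSets E A B S) (hT : SeparatesSets E A (insert x S) T) :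
    SeparatesSets (insert (x, y) E) A B T := by
  intro l hl
  have hm := hS.mem_or_mem_of_insert hl
  obtain ⟨hc, ⟨a, ha, hla⟩, -⟩ := hl
  obtain ⟨l₁, z, l₂, rfl, hz, h₁⟩ :=
    List.exists_eq_append_cons_first (P := insert x S) (l := l) (by grind)
  rw [List.isChain_split] at hc
  have hc' := isChain_of_insert_of_notMem_init hc.1 (fun h => h₁ x h (by simp))
  obtain ⟨w, hw, hwT⟩ := hT (l₁ ++ [z])
    ⟨hc', ⟨a, ha, by cases l₁ <;> simpa using hla⟩, ⟨z, hz, by simp⟩⟩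
  exact ⟨w, by grind, hwT⟩

theorem SeparatesSets.insert_right {E : Finset (V × V)} {A B S T : Finset V} {x y : V}
    (hS : SeparatesSets E A B S) (hT : SeparatesSets E (insert y S) B T) :
    SeparatesSets (insert (x, y) E) A B T := by
  intro l hl
  have hm := hS.mem_or_mem_of_insert hl
  obtain ⟨hc, -, ⟨b, hb, hlb⟩⟩ := hl
  obtain ⟨l₁, z, l₂, rfl, hz, h₂⟩ :=
    List.exists_eq_append_cons_last (P := insert y S) (l := l) (by grind)
  rw [List.isChain_split] at hc
  have hc' := isChain_of_insert_of_notMem_tail hc.2 (fun h => h₂ y h (by simp))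
  obtain ⟨w, hw, hwT⟩ := hT (z :: l₂)
    ⟨hc', ⟨z, hz, by simp⟩, ⟨b, hb, by simpa [List.getLast?_append] using hlb⟩⟩
  exact ⟨w, by grind, hwT⟩

/-- A disjoint family of as many lists as `P` has elements, each with its own distinguished
entry in `P`, can be indexed by these entries. -/
theorem exists_indexed_by_distinguished {P : Finset V} {k : ℕ} (hP : P.card = k)
    (f : Fin k → List V) (e : List V → Option V) (he : ∀ l p, e l = some p → p ∈ l)
    (hf : ∀ i, ∃ p ∈ P, e (f i) = some p) (hd : ∀ i j, i ≠ j → (f i).Disjoint (f j)) :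
    ∃ g : V → List V, (∀ p ∈ P, e (g p) = some p ∧ ∃ i, g p = f i) ∧
      ∀ p ∈ P, ∀ q ∈ P, ∀ w, w ∈ g p → w ∈ g q → p = q := by
  choose t htP ht using hf
  have hinj : Function.Injective t := by
    intro i j hij
    by_contra hne
    exact hd i j hne (he _ _ (ht i)) (hij ▸ he _ _ (ht j))
  have himg : Finset.univ.image t = P := by
    apply Finset.eq_of_subset_of_card_le
    · intro p hp
      obtain ⟨i, -, rfl⟩ := Finset.mem_image.1 hp
      exact htP i
    · rw [Finset.card_image_of_injective _ hinj, hP]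
      simp
  have hsurj : ∀ p, ∃ l, p ∈ P → ∃ i, l = f i ∧ t i = p := by
    intro p
    by_cases hp : p ∈ P
    · obtain ⟨i, -, hi⟩ := Finset.mem_image.1 (himg.symm ▸ hp)
      exact ⟨f i, fun _ => ⟨i, rfl, hi⟩⟩
    · exact ⟨[], fun h => absurd h hp⟩
  choose g hg using hsurj
  refine ⟨g, fun p hp => ?_, fun p hp q hq w hwp hwq => ?_⟩
  · obtain ⟨i, hi, rfl⟩ := hg p hp
    exact ⟨hi ▸ ht i, i, hi⟩
  · obtain ⟨i, hi, rfl⟩ := hg p hp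
    obtain ⟨j, hj, rfl⟩ := hg q hq
    by_contra hne
    exact hd i j (fun h => hne (h ▸ rfl)) (hi ▸ hwp) (hj ▸ hwq)

theorem SeparatesSets.exists_disjoint_links_insert {E : Finset (V × V)} {A B S : Finset V}
    {x y : V} {k : ℕ} (hS : SeparatesSets E A B S) (hx : x ∉ S) (hy : y ∉ S)
    (hP : (insert x S).card = k) {f g : V → List V}
    (hf : ∀ p ∈ insert x S,
      (f p).getLast? = some p ∧ IsLink E A (insert x S) (f p) ∧ (f p).Nodup)
    (hg : ∀ q ∈ insert y S,
      (g q).head? = some q ∧ IsLink E (insert y S) B (g q) ∧ (g q).Nodup)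
    (hfd : ∀ p ∈ insert x S, ∀ q ∈ insert x S, ∀ w, w ∈ f p → w ∈ f q → p = q)
    (hgd : ∀ p ∈ insert y S, ∀ q ∈ insert y S, ∀ w, w ∈ g p → w ∈ g q → p = q) :
    ∃ f : Fin k → List V, (∀ i, IsLink (insert (x, y) E) A B (f i) ∧ (f i).Nodup) ∧
      ∀ i j, i ≠ j → (f i).Disjoint (f j) := by
  have hfg : ∀ p ∈ insert x S, ∀ q ∈ insert y S, ∀ w, w ∈ f p → w ∈ g q →
      w = p ∧ w = q ∧ w ∈ S := fun p hp q hq w hwp hwq =>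
    hS.eq_of_mem_of_mem (Finset.subset_insert x S) (Finset.subset_insert y S) hf hg hfd hgd
      hp hq hwp hwq
  let c : V → V := fun p => if p = x then y else p
  let g' : V → List V := fun p => if p = x then g y else (g p).tail
  have hc : ∀ p ∈ insert x S, c p ∈ insert y S := by grind
  have hcinj : ∀ p ∈ insert x S, ∀ q ∈ insert x S, c p = c q → p = q := by grind
  have hg' : ∀ p w, w ∈ g' p → w ∈ g (c p) := by
    intro p w hw
    by_cases hpx : p = x
    · simpa [g', c, hpx] using hw
    · simp only [g', c, hpx, if_false] at hw ⊢
      exact List.mem_of_mem_tail hw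
  have hlink : ∀ p ∈ insert x S,
      IsLink (insert (x, y) E) A B (f p ++ g' p) ∧ (f p ++ g' p).Nodup := by
    intro p hp
    obtain ⟨hl, ⟨hc₁, ⟨a, ha, hla⟩, -⟩, hn₁⟩ := hf p hp
    obtain ⟨hh, ⟨hc₂, -, ⟨b, hb, hlb⟩⟩, hn₂⟩ := hg (c p) (hc p hp)
    have hfg' := hfg p hp (c p) (hc p hp)
    replace hc₁ := hc₁.imp (S := fun a b => (a, b) ∈ insert (x, y) E)
      fun _ _ => Finset.mem_insert_of_mem
    replace hc₂ := hc₂.imp (S := fun a b => (a, b) ∈ insert (x, y) E)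
      fun _ _ => Finset.mem_insert_of_mem
    by_cases hpx : p = x
    · subst hpx
      simp only [c, g', if_true] at *
      refine ⟨⟨List.isChain_append.2 ⟨hc₁, hc₂, by simp [hl, hh]⟩, ⟨a, ha, by simp [hla]⟩,
        ⟨b, hb, by simp [hlb]⟩⟩, List.nodup_append'.2 ⟨hn₁, hn₂, fun w hw hw' => ?_⟩⟩
      obtain ⟨rfl, -, hwS⟩ := hfg' w hw hw'
      exact hx hwS
    · simp only [c, g', hpx, if_false] at *
      obtain ⟨m, hm⟩ : ∃ m, g p = p :: m := by
        cases hgp : g p with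
        | nil => simp [hgp] at hh
        | cons z m => exact ⟨m, by simpa [hgp] using hh⟩
      rw [hm] at hc₂ hlb hn₂ hfg' ⊢
      simp only [List.tail_cons]
      refine ⟨⟨List.isChain_append.2 ⟨hc₁, hc₂.tail, ?_⟩, ⟨a, ha, by simp [hla]⟩, ⟨b, hb, ?_⟩⟩,
        List.nodup_append'.2 ⟨hn₁, hn₂.of_cons, fun w hw hw' => ?_⟩⟩
      · intro a' ha' b' hb'
        rw [hl, Option.mem_some_iff] at ha'
        subst ha'
        exact (List.isChain_cons.1 hc₂).1 b' hb'
      · cases m with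
        | nil => simpa [hl] using hlb
        | cons z m => simpa using hlb
      · obtain ⟨rfl, -⟩ := hfg' w hw (by simp [hw'])
        exact (List.nodup_cons.1 hn₂).1 hw'
  let t := (Finset.equivFinOfCardEq hP).symm
  refine ⟨fun i => f (t i) ++ g' (t i), fun i => hlink _ (t i).2,
    fun i j hij w hwi hwj => ?_⟩
  have hne : (t i : V) ≠ t j := fun h => hij (t.injective (Subtype.ext h))
  have cross : ∀ p ∈ insert x S, ∀ q ∈ insert x S, w ∈ f p → w ∈ g' q → p = q := by
    intro p hp q hq hwp hwq
    obtain ⟨rfl, h₁, hwS⟩ := hfg p hp (c q) (hc q hq) w hwp (hg' q w hwq)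
    by_cases hqx : q = x
    · simp only [c, hqx, if_true] at h₁
      exact absurd (h₁ ▸ hwS) hy
    · simpa only [c, hqx, if_false] using h₁
  have hi := (t i).2
  have hj := (t j).2
  rcases List.mem_append.1 hwi with hwi | hwi <;> rcases List.mem_append.1 hwj with hwj | hwj
  · exact hne (hfd _ hi _ hj w hwi hwj)
  · exact hne (cross _ hi _ hj hwi hwj)
  · exact hne (cross _ hj _ hi hwj hwi).symm
  · exact hne (hcinj _ hi _ hj
      (hgd _ (hc _ hi) _ (hc _ hj) w (hg' _ w hwi) (hg' _ w hwj)))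

/-- **Menger's theorem** for digraphs, between two sets of vertices. -/
theorem exists_disjoint_links (E : Finset (V × V)) (A B : Finset V) (k : ℕ)
    (h : ∀ S, SeparatesSets E A B S → k ≤ S.card) :
    ∃ f : Fin k → List V, (∀ i, IsLink E A B (f i) ∧ (f i).Nodup) ∧
      ∀ i j, i ≠ j → (f i).Disjoint (f j) := by
  induction E using Finset.induction_on generalizing A B k with
  | empty =>
    have hk : k ≤ (A ∩ B).card := by
      refine h _ fun l ⟨hc, ⟨a, ha, hla⟩, ⟨b, hb, hlb⟩⟩ => ?_
      match l, hc with
      | [], _ => simp at hla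
      | [c], _ => exact ⟨c, by simp, by simp_all⟩
      | c :: d :: l, hc => simp at hc
    obtain ⟨T, hT, hTk⟩ := Finset.exists_subset_card_eq hk
    let t := (Finset.equivFinOfCardEq hTk).symm
    refine ⟨fun i => [(t i : V)], fun i => ⟨⟨by simp, ⟨t i, ?_, by simp⟩, ⟨t i, ?_, by simp⟩⟩,
      by simp⟩, fun i j hij => ?_⟩
    · exact (Finset.mem_inter.1 (hT (t i).2)).1
    · exact (Finset.mem_inter.1 (hT (t i).2)).2
    · simpa [Subtype.ext_iff] using fun h => hij (t.injective (Subtype.ext h)).symm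
  | insert e E _ ih =>
    obtain ⟨x, y⟩ := e
    by_cases hE : ∀ S, SeparatesSets E A B S → k ≤ S.card
    · obtain ⟨f, hf, hd⟩ := ih A B k hE
      exact ⟨f, fun i => ⟨⟨(hf i).1.1.imp fun _ _ => Finset.mem_insert_of_mem, (hf i).1.2⟩,
        (hf i).2⟩, hd⟩
    push Not at hE
    obtain ⟨S, hS, hSk⟩ := hE
    have hPk : k ≤ (insert x S).card := h _ fun l hl => by
      have := hS.mem_or_mem_of_insert hl
      grind
    have hQk : k ≤ (insert y S).card := h _ fun l hl => by
      have := hS.mem_or_mem_of_insert hl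
      grind
    have hx : x ∉ S := fun hx => by
      rw [Finset.insert_eq_of_mem hx] at hPk
      omega
    have hy : y ∉ S := fun hy => by
      rw [Finset.insert_eq_of_mem hy] at hQk
      omega
    have hP : (insert x S).card = k := by
      rw [Finset.card_insert_of_notMem hx] at *
      omega
    have hQ : (insert y S).card = k := by
      rw [Finset.card_insert_of_notMem hy] at *
      omega
    obtain ⟨f₀, hf₀, hfd₀⟩ := ih A (insert x S) k fun T hT => h T (hS.insert_left hT)
    obtain ⟨g₀, hg₀, hgd₀⟩ := ih (insert y S) B k fun T hT => h T (hS.insert_right hT)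
    obtain ⟨f, hf, hfd⟩ := exists_indexed_by_distinguished hP f₀ List.getLast?
      (fun _ _ => List.mem_of_getLast?) (fun i => (hf₀ i).1.2.2) hfd₀
    obtain ⟨g, hg, hgd⟩ := exists_indexed_by_distinguished hQ g₀ List.head?
      (fun _ _ => List.mem_of_head?) (fun i => (hg₀ i).1.2.1) hgd₀
    replace hf : ∀ p ∈ insert x S,
        (f p).getLast? = some p ∧ IsLink E A (insert x S) (f p) ∧ (f p).Nodup := fun p hp => by
      obtain ⟨h₁, i, h₂⟩ := hf p hp
      exact ⟨h₁, h₂ ▸ hf₀ i⟩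
    replace hg : ∀ q ∈ insert y S,
        (g q).head? = some q ∧ IsLink E (insert y S) B (g q) ∧ (g q).Nodup := fun q hq => by
      obtain ⟨h₁, i, h₂⟩ := hg q hq
      exact ⟨h₁, h₂ ▸ hg₀ i⟩
    exact hS.exists_disjoint_links_insert hx hy hP hf hg hfd hgd

end Menger

section Separation

variable {n : ℕ} {G : SimpleGraph (Fin n)} {u v : Fin n}

theorem le_of_disjoint_paths {k : ℕ} {P : Fin k → G.Walk u v}
    (hP : ∀ i, (P i).IsPath ∧ 2 ≤ (P i).length)
    (hd : ∀ i j, i ≠ j → ∀ w, w ∈ (P i).support → w ∈ (P j).support → w = u ∨ w = v) :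
    k ≤ n := by
  have hne : ∀ i, (P i).getVert 1 ≠ u ∧ (P i).getVert 1 ≠ v := fun i => by
    obtain ⟨hp, hl⟩ := hP i
    constructor
    · rw [ne_eq, hp.getVert_eq_start_iff (by omega)]
      omega
    · rw [ne_eq, hp.getVert_eq_end_iff (by omega)]
      omega
  have hinj : Function.Injective fun i => (P i).getVert 1 := by
    intro i j hij
    by_contra hne'
    have := hd i j hne' _ ((P i).getVert_mem_support 1)
      (by simp only at hij; rw [hij]; exact (P j).getVert_mem_support 1)
    exact this.elim (hne i).1 (hne i).2
  simpa using Fintype.card_le_of_injective _ hinj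

theorem le_pairConn {k : ℕ} {P : Fin k → G.Walk u v}
    (hP : ∀ i, (P i).IsPath ∧ 2 ≤ (P i).length)
    (hd : ∀ i j, i ≠ j → ∀ w, w ∈ (P i).support → w ∈ (P j).support → w = u ∨ w = v) :
    k ≤ pairConn G u v :=
  le_csSup ⟨n, fun _ ⟨_, hQ, hQd⟩ => le_of_disjoint_paths hQ hQd⟩ ⟨P, hP, hd⟩

theorem exists_disjoint_paths (G : SimpleGraph (Fin n)) (u v : Fin n) :
    ∃ P : Fin (pairConn G u v) → G.Walk u v,
      (∀ i, (P i).IsPath ∧ 2 ≤ (P i).length) ∧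
      ∀ i j, i ≠ j → ∀ w, w ∈ (P i).support → w ∈ (P j).support → w = u ∨ w = v :=
  Nat.sSup_mem (s := {k : ℕ | ∃ P : Fin k → G.Walk u v,
      (∀ i, (P i).IsPath ∧ 2 ≤ (P i).length) ∧
      ∀ i j, i ≠ j → ∀ w, w ∈ (P i).support → w ∈ (P j).support → w = u ∨ w = v})
    ⟨0, fun i => i.elim0, fun i => i.elim0, fun i => i.elim0⟩
    ⟨n, fun _ ⟨_, hQ, hQd⟩ => le_of_disjoint_paths hQ hQd⟩

theorem pairConn_le (G : SimpleGraph (Fin n)) (u v : Fin n) : pairConn G u v ≤ n := by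
  obtain ⟨P, hP, hd⟩ := exists_disjoint_paths G u v
  exact le_of_disjoint_paths hP hd

theorem pairConn_mono {G H : SimpleGraph (Fin n)} (h : G ≤ H) (u v : Fin n) :
    pairConn G u v ≤ pairConn H u v := by
  obtain ⟨P, hP, hd⟩ := exists_disjoint_paths G u v
  refine le_pairConn (P := fun i => (P i).mapLe h)
    (fun i => ⟨(hP i).1.mapLe h, by simpa using (hP i).2⟩) ?_
  simpa using hd

theorem pairConn_le_maxPairConn (G : SimpleGraph (Fin n)) (huv : u ≠ v) :
    pairConn G u v ≤ maxPairConn G :=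
  le_csSup ⟨n, fun _ ⟨a, b, _, hk⟩ => hk ▸ pairConn_le G a b⟩ ⟨u, v, huv, rfl⟩

/-- **Menger's theorem** for two non-adjacent vertices. -/
theorem exists_separates_card_le_pairConn (huv : u ≠ v) (hadj : ¬ G.Adj u v) :
    ∃ S : Finset (Fin n), u ∉ S ∧ v ∉ S ∧ Separates G u v S ∧ S.card ≤ pairConn G u v := by
  classical
  let A : Finset (Fin n) := {a | G.Adj u a}
  let B : Finset (Fin n) := {b | G.Adj b v}
  let E : Finset (Fin n × Fin n) :=
    {e | G.Adj e.1 e.2 ∧ e.2 ≠ u ∧ e.2 ≠ v}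
  have hE : ∀ (l : List (Fin n)) (a : Fin n), a ≠ u → a ≠ v →
      (a :: l).IsChain (fun a b => (a, b) ∈ E) → u ∉ a :: l ∧ v ∉ a :: l := by
    intro l
    induction l with grind
  have hE' : ∀ l : List (Fin n), u ∉ l → v ∉ l → l.IsChain G.Adj →
      l.IsChain (fun a b => (a, b) ∈ E) := by
    intro l
    induction l using List.twoStepInduction with grind
  have hsep : ∀ S, SeparatesSets E A B S → Separates G u v (S \ {u, v}) := by
    intro S hS p
    suffices ∃ w ∈ p.bypass.support, w ∈ S \ {u, v} by
      obtain ⟨w, hw, hwS⟩ := this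
      exact ⟨w, p.support_bypass_subset_support hw, hwS⟩
    have hp := p.bypass_isPath
    generalize p.bypass = q at hp
    cases q with
    | nil => exact absurd rfl huv
    | @cons _ a _ h r =>
      rw [SimpleGraph.Walk.cons_isPath_iff] at hp
      obtain ⟨l, hl⟩ : ∃ l, r.support = l ++ [v] :=
        ⟨r.support.dropLast, by simp⟩
      have hn := hp.1.support_nodup
      have hu := hp.2
      have hc := r.isChain_adj_support
      have hhead := r.cons_tail_support.symm
      rw [SimpleGraph.Walk.support_cons]
      rw [hl] at hn hu hc hhead ⊢
      obtain _ | ⟨a', l⟩ := l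
      · have : v = a := by simpa using (List.cons.inj hhead).1
        exact absurd (this ▸ h) hadj
      obtain rfl : a' = a := (List.cons.inj hhead).1
      rw [List.isChain_append] at hc
      have hv : v ∉ a' :: l := by grind
      obtain ⟨w, hw, hwS⟩ := hS (a' :: l)
        ⟨hE' _ (by grind) hv hc.1, ⟨a', by simpa [A] using h, rfl⟩,
        ⟨(a' :: l).getLast (by simp), by
          simpa [B] using hc.2.2 _ (List.getLast?_eq_some_getLast (by simp)) v (by simp),
          List.getLast?_eq_some_getLast (by simp)⟩⟩
      exact ⟨w, by grind, by grind⟩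
  by_contra! hcon
  obtain ⟨f, hf, hd⟩ := exists_disjoint_links E A B (pairConn G u v + 1) fun S hS =>
    (Nat.succ_le_of_lt (hcon _ (by simp) (by simp) (hsep S hS))).trans
      (Finset.card_le_card Finset.sdiff_subset)
  have hfuv : ∀ i, u ∉ f i ∧ v ∉ f i ∧ f i ≠ [] := by
    intro i
    obtain ⟨⟨hc, ⟨a, ha, hla⟩, -⟩, -⟩ := hf i
    obtain ⟨l, hl⟩ : ∃ l, f i = a :: l := List.head?_eq_some_iff.1 hla
    rw [hl] at hc ⊢
    have ha : G.Adj u a := by simpa [A] using ha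
    have := hE l a ha.ne' (fun h => hadj (h ▸ ha)) hc
    exact ⟨this.1, this.2, by simp⟩
  have hw : ∀ i, ∃ p : G.Walk u v, p.support = u :: (f i ++ [v]) := by
    intro i
    obtain ⟨⟨hc, ⟨a, ha, hla⟩, ⟨b, hb, hlb⟩⟩, -⟩ := hf i
    have ha : G.Adj u a := by simpa [A] using ha
    have hb : G.Adj b v := by simpa [B] using hb
    have hc : (f i).IsChain G.Adj := hc.imp fun _ _ h => by simp [E] at h; exact h.1
    have hchain : (u :: (f i ++ [v])).IsChain G.Adj :=
      List.isChain_cons.2 ⟨by simp [hla, ha],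
        List.isChain_append.2 ⟨hc, by simp, by simp [hlb, hb]⟩⟩
    have hne : u :: (f i ++ [v]) ≠ [] := List.cons_ne_nil _ _
    have hhead : (u :: (f i ++ [v])).head hne = u := by simp
    have hlast : (u :: (f i ++ [v])).getLast hne = v := by simp
    exact ⟨(SimpleGraph.Walk.ofSupport _ hne hchain).copy hhead hlast, by
      rw [SimpleGraph.Walk.support_copy, SimpleGraph.Walk.support_ofSupport]⟩
  choose P hPs using hw
  have : pairConn G u v + 1 ≤ pairConn G u v := by
    refine le_pairConn (P := P) (fun i => ⟨?_, ?_⟩) fun i j hij w hwi hwj => ?_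
    · have := hfuv i
      rw [SimpleGraph.Walk.isPath_def, hPs]
      grind
    · have h₁ := (P i).length_support
      have h₂ := List.length_pos_iff.2 (hfuv i).2.2
      simp only [hPs, List.length_cons, List.length_append, List.length_nil] at h₁
      omega
    · rw [hPs] at hwi hwj
      have := fun h₁ h₂ => hd i j hij (a := w) h₁ h₂
      grind
  omega

theorem Separates.mono {S T : Finset (Fin n)} (h : Separates G u v S) (hST : S ⊆ T) :
    Separates G u v T := fun p =>
  let ⟨w, hw, hwS⟩ := h p
  ⟨w, hw, hST hwS⟩

theorem not_separates_of_adj {S : Finset (Fin n)} (h : G.Adj u v) (hu : u ∉ S) (hv : v ∉ S) :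
    ¬ Separates G u v S := fun hS => by
  obtain ⟨w, hw, hwS⟩ := hS h.toWalk
  simp at hw
  grind

theorem two_pow_le_ncard_separates {k : ℕ} (huv : u ≠ v) (hadj : ¬ G.Adj u v)
    (hk : pairConn G u v ≤ k) :
    2 ^ (n - 2 - k) ≤ Set.ncard {S : Finset (Fin n) | u ∉ S ∧ v ∉ S ∧ Separates G u v S} := by
  obtain ⟨S, hu, hv, hS, hcard⟩ := exists_separates_card_le_pairConn huv hadj
  have hsub : S ⊆ (Finset.univ.erase u).erase v := by
    intro w hw
    grind
  calc 2 ^ (n - 2 - k) ≤ 2 ^ (n - 2 - S.card) := Nat.pow_le_pow_right two_pos (by omega)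
    _ = (Finset.Icc S ((Finset.univ.erase u).erase v)).card := by
      rw [Finset.card_Icc_finset hsub, Finset.card_erase_of_mem (by simp [huv.symm]),
        Finset.card_erase_of_mem (by simp), Finset.card_univ, Fintype.card_fin, Nat.sub_sub n 1 1]
    _ ≤ _ := by
      rw [← Set.ncard_coe_finset]
      refine Set.ncard_le_ncard (fun T hT => ?_) (Set.toFinite _)
      rw [Finset.mem_coe, Finset.mem_Icc] at hT
      exact ⟨fun h => by simpa using hT.2 h, fun h => by simpa using hT.2 h, hS.mono hT.1⟩

end Separation

theorem distinct_graphs_many_differing_separation_statements {n : ℕ}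
    (G₁ G₂ : SimpleGraph (Fin n)) (h : G₁ ≠ G₂) :
    ∃ u v : Fin n, u ≠ v ∧
      2 ^ (n - 2 - maxPairConn G₁) ≤
        Set.ncard {S : Finset (Fin n) | u ∉ S ∧ v ∉ S ∧
          ¬ (Separates G₁ u v S ↔ Separates G₂ u v S)} := by
  by_cases hle : G₂ ≤ G₁
  · obtain ⟨u, v, h₁, h₂⟩ : ∃ u v, G₁.Adj u v ∧ ¬ G₂.Adj u v := by
      by_contra! hcon
      exact h (le_antisymm (fun u v => hcon u v) hle)
    refine ⟨u, v, h₁.ne, (two_pow_le_ncard_separates h₁.ne h₂ ((pairConn_mono hle u v).trans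
      (pairConn_le_maxPairConn G₁ h₁.ne))).trans (Set.ncard_le_ncard ?_ (Set.toFinite _))⟩
    rintro S ⟨hu, hv, hS⟩
    exact ⟨hu, hv, fun hiff => not_separates_of_adj h₁ hu hv (hiff.2 hS)⟩
  · obtain ⟨u, v, h₂, h₁⟩ : ∃ u v, G₂.Adj u v ∧ ¬ G₁.Adj u v := by
      by_contra! hcon
      exact hle fun u v => hcon u v
    refine ⟨u, v, h₂.ne, (two_pow_le_ncard_separates h₂.ne h₁
      (pairConn_le_maxPairConn G₁ h₂.ne)).trans (Set.ncard_le_ncard ?_ (Set.toFinite _))⟩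
    rintro S ⟨hu, hv, hS⟩
    exact ⟨hu, hv, fun hiff => not_separates_of_adj h₂ hu hv (hiff.1 hS)⟩
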